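/- arXiv:1602.07062 — 2 statements merged into one kernel-verified Lean document; each statement's English description precedes it below -/
import Mathlib

section
/- Let m, s be nonnegative integers, let κ be a nonzero real number and b a nonzero real number. Define c_0 = 1 and, for 1 ≤ j ≤ s, c_j = Π_{k=0}^{j−1} ( −(2(s−k) − 1)(2(m+s−k) − 1)/κ² ). Then ∫₀^b t^{m+2s} J_m(κt) dt = (1/κ) b^{m} J_{m+1}(κb) · Σ_{j=1}^{s} c_{s−j} b^{2j} + (1/κ²) b^{m−1} J_m(κb) · Σ_{j=1}^{s} c_{s−j} (2j − 1) b^{2j} + c_s · ∫₀^b t^{m} J_m(κt) dt. -/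
open Real MeasureTheory

/-- Bessel function of the first kind of nonnegative integer order `m`. -/
noncomputable def besselJ (m : ℕ) (x : ℝ) : ℝ :=
  ∑' j : ℕ, ((-1 : ℝ) ^ j / ((j.factorial : ℝ) * ((j + m).factorial : ℝ))) * (x / 2) ^ (2 * j + m)

/-- The entire function `∑ (-y)^j / (j! (j+m)!)`, the regular factor of the Bessel function:
`J_m(x) = (x/2)^m * besselClifford m (x²/4)`. -/
noncomputable def besselClifford (m : ℕ) (y : ℝ) : ℝ :=
  ∑' j : ℕ, ((-1 : ℝ) ^ j / ((j.factorial : ℝ) * ((j + m).factorial : ℝ))) * y ^ j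

lemma besselClifford_term_norm_le (m j : ℕ) {y R : ℝ} (hy : |y| ≤ R) :
    ‖((-1 : ℝ) ^ j / ((j.factorial : ℝ) * ((j + m).factorial : ℝ))) * y ^ j‖ ≤
      R ^ j / j.factorial := by
  have h1 : (1 : ℝ) ≤ ((j + m).factorial : ℝ) := by exact_mod_cast Nat.factorial_pos _
  have h2 : (0 : ℝ) < (j.factorial : ℝ) := by exact_mod_cast Nat.factorial_pos _
  rw [norm_mul, norm_div, norm_pow, norm_neg, norm_one, one_pow, norm_pow, Real.norm_eq_abs,
    Real.norm_eq_abs, abs_of_pos (by positivity), one_div_mul_eq_div]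
  have hR : 0 ≤ R := (abs_nonneg y).trans hy
  gcongr
  exact le_mul_of_one_le_right h2.le h1

lemma summable_besselClifford (m : ℕ) (y : ℝ) :
    Summable fun j : ℕ =>
      ((-1 : ℝ) ^ j / ((j.factorial : ℝ) * ((j + m).factorial : ℝ))) * y ^ j :=
  .of_norm_bounded (Real.summable_pow_div_factorial |y|)
    fun j => besselClifford_term_norm_le m j le_rfl

lemma hasDerivAt_besselClifford (m : ℕ) (y : ℝ) :
    HasDerivAt (besselClifford m) (-besselClifford (m + 1) y) y := by
  have hfun : besselClifford m = fun z => 1 / (m.factorial : ℝ) +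
      ∑' j : ℕ, ((-1 : ℝ) ^ (j + 1) / (((j + 1).factorial : ℝ) * ((j + 1 + m).factorial : ℝ))) *
        z ^ (j + 1) := by
    funext z
    rw [besselClifford, (summable_besselClifford m z).tsum_eq_zero_add]
    simp
  rw [hfun, besselClifford, ← tsum_neg]
  refine HasDerivAt.const_add _ ?_
  refine hasDerivAt_tsum_of_isPreconnected (t := Metric.ball (0 : ℝ) (|y| + 1))
    (g' := fun j z =>
      -(((-1 : ℝ) ^ j / ((j.factorial : ℝ) * ((j + (m + 1)).factorial : ℝ))) * z ^ j))
    (Real.summable_pow_div_factorial (|y| + 1)) Metric.isOpen_ball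
    (convex_ball _ _).isPreconnected (y₀ := 0) ?_ ?_ ?_ ?_ ?_
  · intro j z _
    have h := (hasDerivAt_pow (j + 1) z).const_mul
      ((-1 : ℝ) ^ (j + 1) / (((j + 1).factorial : ℝ) * ((j + 1 + m).factorial : ℝ)))
    refine h.congr_deriv ?_
    rw [Nat.factorial_succ j, show j + 1 + m = j + (m + 1) by ring]
    have h1 : ((j + (m + 1)).factorial : ℝ) ≠ 0 := by exact_mod_cast Nat.factorial_ne_zero _
    have h2 : (j.factorial : ℝ) ≠ 0 := by exact_mod_cast Nat.factorial_ne_zero _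
    have h3 : (j : ℝ) + 1 ≠ 0 := by positivity
    push_cast
    field_simp
    ring
  · intro j z hz
    rw [norm_neg]
    exact besselClifford_term_norm_le (m + 1) j (by simpa using (mem_ball_zero_iff.mp hz).le)
  · simp; positivity
  · simp
  · simp

lemma besselClifford_recurrence (m : ℕ) (y : ℝ) :
    besselClifford m y =
      (m + 1) * besselClifford (m + 1) y - y * besselClifford (m + 2) y := by
  have hm := (summable_besselClifford (m + 1) y).mul_left ((m : ℝ) + 1)
  have h2 := (summable_besselClifford (m + 2) y).mul_left y
  have h0 := summable_besselClifford m y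
  simp only [besselClifford]
  rw [← tsum_mul_left, ← tsum_mul_left, h0.tsum_eq_zero_add, hm.tsum_eq_zero_add,
    add_sub_assoc, ← ((summable_nat_add_iff 1).mpr hm).tsum_sub h2]
  congr 1
  · have h1 : (m.factorial : ℝ) ≠ 0 := by exact_mod_cast Nat.factorial_ne_zero _
    have h3 : (m : ℝ) + 1 ≠ 0 := by positivity
    simp [Nat.factorial_succ]
    field_simp
  · refine tsum_congr fun j => ?_
    rw [show j + 1 + (m + 1) = (j + 1 + m) + 1 by ring, show j + (m + 2) = (j + 1 + m) + 1 by ring,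
      Nat.factorial_succ (j + 1 + m), Nat.factorial_succ j]
    have h1 : ((j + 1 + m).factorial : ℝ) ≠ 0 := by exact_mod_cast Nat.factorial_ne_zero _
    have h2 : (j.factorial : ℝ) ≠ 0 := by exact_mod_cast Nat.factorial_ne_zero _
    have h3 : (j : ℝ) + 1 ≠ 0 := by positivity
    have h4 : (j : ℝ) + 1 + m + 1 ≠ 0 := by positivity
    push_cast
    field_simp
    ring

lemma besselJ_eq_besselClifford (m : ℕ) (x : ℝ) :
    besselJ m x = (x / 2) ^ m * besselClifford m ((x / 2) ^ 2) := by
  rw [besselJ, besselClifford, ← tsum_mul_left]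
  refine tsum_congr fun j => ?_
  rw [pow_add, pow_mul]
  ring

lemma continuous_besselJ (m : ℕ) : Continuous (besselJ m) := by
  have hC : Continuous (besselClifford m) :=
    continuous_iff_continuousAt.mpr fun y => (hasDerivAt_besselClifford m y).continuousAt
  rw [funext (besselJ_eq_besselClifford m)]
  fun_prop

lemma hasDerivAt_sq_mul_div_two (κ t : ℝ) :
    HasDerivAt (fun t : ℝ => (κ * t / 2) ^ 2) (κ ^ 2 * t / 2) t := by
  refine ((((hasDerivAt_id t).const_mul κ).div_const 2).pow 2).congr_deriv ?_
  simp only [id]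
  push_cast
  ring

/-- `d/dx (x^{m+1} J_{m+1}(x)) = x^{m+1} J_m(x)`, rescaled by `κ`. -/
lemma hasDerivAt_pow_mul_besselJ_succ (m : ℕ) (κ t : ℝ) :
    HasDerivAt (fun t => t ^ (m + 1) * besselJ (m + 1) (κ * t))
      (κ * (t ^ (m + 1) * besselJ m (κ * t))) t := by
  have hC := (hasDerivAt_besselClifford (m + 1) ((κ * t / 2) ^ 2)).comp t (hasDerivAt_sq_mul_div_two κ t)
  have h := ((hasDerivAt_pow (2 * m + 2) t).const_mul ((κ / 2) ^ (m + 1))).mul hC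
  have hfun : (fun t => t ^ (m + 1) * besselJ (m + 1) (κ * t)) = fun t =>
      (κ / 2) ^ (m + 1) * t ^ (2 * m + 2) * besselClifford (m + 1) ((κ * t / 2) ^ 2) := by
    funext u
    rw [besselJ_eq_besselClifford, show κ * u / 2 = κ / 2 * u by ring, mul_pow]
    ring
  rw [hfun]
  refine h.congr_deriv ?_
  rw [besselJ_eq_besselClifford m, besselClifford_recurrence m]
  simp only [Function.comp_apply, show 2 * m + 2 - 1 = 2 * m + 1 by omega]
  rw [show κ * t / 2 = κ / 2 * t by ring]
  push_cast
  rw [mul_pow _ _ m]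
  ring

/-- `d/dx (x^{p+1} J_m(x)) = (m+p+1) x^p J_m(x) - x^{p+1} J_{m+1}(x)`, rescaled by `κ`. -/
lemma hasDerivAt_pow_mul_besselJ (m p : ℕ) (κ t : ℝ) :
    HasDerivAt (fun t => t ^ (p + 1) * besselJ m (κ * t))
      ((m + p + 1) * (t ^ p * besselJ m (κ * t)) -
        κ * (t ^ (p + 1) * besselJ (m + 1) (κ * t))) t := by
  have hC := (hasDerivAt_besselClifford m ((κ * t / 2) ^ 2)).comp t (hasDerivAt_sq_mul_div_two κ t)
  have h := ((hasDerivAt_pow (m + p + 1) t).const_mul ((κ / 2) ^ m)).mul hC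
  have hfun : (fun t => t ^ (p + 1) * besselJ m (κ * t)) = fun t =>
      (κ / 2) ^ m * t ^ (m + p + 1) * besselClifford m ((κ * t / 2) ^ 2) := by
    funext u
    rw [besselJ_eq_besselClifford, show κ * u / 2 = κ / 2 * u by ring, mul_pow]
    ring
  rw [hfun]
  refine h.congr_deriv ?_
  rw [besselJ_eq_besselClifford m, besselJ_eq_besselClifford (m + 1)]
  simp only [Function.comp_apply, Nat.add_sub_cancel]
  rw [show κ * t / 2 = κ / 2 * t by ring]
  push_cast
  rw [mul_pow _ _ m, mul_pow _ _ (m + 1)]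
  ring

lemma integral_pow_mul_besselJ_succ (m n : ℕ) {κ : ℝ} (hκ : κ ≠ 0) (b : ℝ) :
    ∫ t in (0:ℝ)..b, t ^ (m + 2 * (n + 1)) * besselJ m (κ * t) =
      1 / κ * b ^ (m + 2 * n + 2) * besselJ (m + 1) (κ * b) +
        1 / κ ^ 2 * (2 * n + 1) * b ^ (m + 2 * n + 1) * besselJ m (κ * b) +
        -((2 * n + 1) * (2 * m + 2 * n + 1)) / κ ^ 2 *
          ∫ t in (0:ℝ)..b, t ^ (m + 2 * n) * besselJ m (κ * t) := by
  have hJ := continuous_besselJ m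
  have hderiv : ∀ t : ℝ, HasDerivAt
      (fun t => 1 / κ * (t ^ (2 * n + 1) * (t ^ (m + 1) * besselJ (m + 1) (κ * t))) +
        1 / κ ^ 2 * (2 * n + 1) * (t ^ (m + 2 * n + 1) * besselJ m (κ * t)))
      (t ^ (m + 2 * (n + 1)) * besselJ m (κ * t) -
        -((2 * n + 1) * (2 * m + 2 * n + 1)) / κ ^ 2 *
          (t ^ (m + 2 * n) * besselJ m (κ * t))) t := by
    intro t
    have h1 := (((hasDerivAt_pow (2 * n + 1) t).mul
      (hasDerivAt_pow_mul_besselJ_succ m κ t)).const_mul (1 / κ))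
    have h2 := (hasDerivAt_pow_mul_besselJ m (m + 2 * n) κ t).const_mul
      (1 / κ ^ 2 * (2 * (n : ℝ) + 1))
    refine (h1.add h2).congr_deriv ?_
    simp only [Nat.add_sub_cancel]
    push_cast
    field_simp
    ring
  have hi1 : IntervalIntegrable (fun t => t ^ (m + 2 * (n + 1)) * besselJ m (κ * t)) volume 0 b :=
    Continuous.intervalIntegrable (by fun_prop) _ _
  have hi2 : IntervalIntegrable (fun t => -((2 * (n : ℝ) + 1) * (2 * m + 2 * n + 1)) / κ ^ 2 *
      (t ^ (m + 2 * n) * besselJ m (κ * t))) volume 0 b :=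
    Continuous.intervalIntegrable (by fun_prop) _ _
  have hF := intervalIntegral.integral_eq_sub_of_hasDerivAt (fun t _ => hderiv t) (hi1.sub hi2)
  rw [intervalIntegral.integral_sub hi1 hi2, intervalIntegral.integral_const_mul,
    sub_eq_iff_eq_add] at hF
  rw [hF]
  simp only [ne_eq, Nat.succ_ne_zero, not_false_eq_true, zero_pow]
  ring

theorem stmt_12 (m s : ℕ) (κ b : ℝ) (hκ : κ ≠ 0) (hb : b ≠ 0) (c : ℕ → ℝ)
    (hc : ∀ j : ℕ, c j =
      ∏ k ∈ Finset.range j,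
        (-((2 * ((s : ℝ) - k) - 1) * (2 * ((m : ℝ) + s - k) - 1)) / κ ^ 2)) :
    ∫ t in (0:ℝ)..b, t ^ (m + 2 * s) * besselJ m (κ * t) =
      (1 / κ) * b ^ m * besselJ (m + 1) (κ * b) *
          (∑ j ∈ Finset.Icc 1 s, c (s - j) * b ^ (2 * j)) +
        (1 / κ ^ 2) * b ^ ((m : ℤ) - 1) * besselJ m (κ * b) *
          (∑ j ∈ Finset.Icc 1 s, c (s - j) * (2 * (j : ℝ) - 1) * b ^ (2 * j)) +
        c s * ∫ t in (0:ℝ)..b, t ^ m * besselJ m (κ * t) := by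
  induction s generalizing c with
  | zero => simp [hc]
  | succ n ih =>
    set q : ℝ := -((2 * n + 1) * (2 * m + 2 * n + 1)) / κ ^ 2 with hq
    set d : ℕ → ℝ := fun j => ∏ k ∈ Finset.range j,
        (-((2 * ((n : ℝ) - k) - 1) * (2 * ((m : ℝ) + n - k) - 1)) / κ ^ 2) with hd
    have hc0 : c 0 = 1 := by simp [hc]
    have hcs : ∀ j, c (j + 1) = q * d j := by
      intro j
      rw [hc, Finset.prod_range_succ', mul_comm]
      congr 1
      · rw [hq]; push_cast; ring
      · refine Finset.prod_congr rfl fun k _ => ?_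
        push_cast; ring
    have hsum : ∀ f : ℕ → ℝ, ∑ j ∈ Finset.Icc 1 (n + 1), c (n + 1 - j) * f j =
        q * (∑ j ∈ Finset.Icc 1 n, d (n - j) * f j) + f (n + 1) := by
      intro f
      rw [Finset.sum_Icc_succ_top (by omega), Nat.sub_self, hc0, one_mul, Finset.mul_sum]
      congr 1
      refine Finset.sum_congr rfl fun j hj => ?_
      rw [Nat.succ_sub (Finset.mem_Icc.mp hj).2, Nat.succ_eq_add_one, hcs, mul_assoc]
    have hz : b ^ ((m : ℤ) - 1) = b ^ m / b := by rw [zpow_sub₀ hb, zpow_natCast, zpow_one]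
    have ih' := ih d fun _ => rfl
    simp only [mul_assoc (c _), mul_assoc (d _)] at ih' ⊢
    rw [integral_pow_mul_besselJ_succ m n hκ b, ih', hsum, hsum, hcs, hz, ← hq]
    push_cast
    field_simp
    ring
end

section
/- Let n, m be nonnegative integers, let κ be a nonzero real number and b a real number. Then ∫₀^b t^n e^{iκt} J_m(κt) dt = (e^{iκb} b^{n+1}/(n+m+1)) · ( J_m(κb) − i J_{m+1}(κb) ) + (i(n − m)/(n+m+1)) ∫₀^b t^n e^{iκt} J_{m+1}(κt) dt. -/
open Real MeasureTheory Complex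

/-- The coefficients of the entire function `g` with `J_m(x) = (x/2)^m g((x/2)^2)`. -/
noncomputable def besselCoeff (m j : ℕ) : ℝ :=
  (-1 : ℝ) ^ j / ((j.factorial : ℝ) * ((j + m).factorial : ℝ))

/-- The entire function `g` with `J_m(x) = (x/2)^m g((x/2)^2)`. -/
noncomputable def besselAux (m : ℕ) (y : ℝ) : ℝ :=
  ∑' j : ℕ, besselCoeff m j * y ^ j

theorem besselJ_eq_pow_mul_besselAux (m : ℕ) (x : ℝ) :
    besselJ m x = (x / 2) ^ m * besselAux m ((x / 2) ^ 2) := by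
  rw [besselJ, besselAux, ← tsum_mul_left]
  refine tsum_congr fun j => ?_
  rw [besselCoeff, pow_add, pow_mul]
  ring

theorem abs_besselCoeff_le (m j : ℕ) : |besselCoeff m j| ≤ 1 / (j.factorial : ℝ) := by
  have hj : (0 : ℝ) < j.factorial := by positivity
  have hm : (1 : ℝ) ≤ (j + m).factorial := by
    exact_mod_cast Nat.one_le_iff_ne_zero.mpr (Nat.factorial_ne_zero _)
  rw [besselCoeff, abs_div, abs_pow, abs_neg, abs_one, one_pow, abs_of_nonneg (by positivity)]
  exact one_div_le_one_div_of_le hj (le_mul_of_one_le_right hj.le hm)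

theorem summable_besselAux (m : ℕ) (y : ℝ) :
    Summable fun j : ℕ => besselCoeff m j * y ^ j := by
  refine .of_norm_bounded (Real.summable_pow_div_factorial |y|) fun j => ?_
  rw [Real.norm_eq_abs, abs_mul, abs_pow, div_eq_mul_one_div, mul_comm]
  gcongr
  exact abs_besselCoeff_le m j

theorem besselCoeff_succ_mul (m j : ℕ) :
    besselCoeff m (j + 1) * ((j : ℝ) + 1) = -besselCoeff (m + 1) j := by
  have h : j + 1 + m = j + (m + 1) := by ring
  rw [besselCoeff, besselCoeff, h, Nat.factorial_succ j, pow_succ]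
  push_cast
  field_simp

theorem besselCoeff_eq (m j : ℕ) :
    besselCoeff m j = ((j : ℝ) + m + 1) * besselCoeff (m + 1) j := by
  have h : (j : ℝ) + m + 1 ≠ 0 := by positivity
  rw [besselCoeff, besselCoeff, ← add_assoc, Nat.factorial_succ (j + m)]
  push_cast
  field_simp

theorem hasDerivAt_besselAux (m : ℕ) (y : ℝ) :
    HasDerivAt (besselAux m) (-besselAux (m + 1) y) y := by
  have hbound : Summable fun j : ℕ => (|y| + 1) ^ (j - 1) / ((j - 1).factorial : ℝ) := by
    rw [← summable_nat_add_iff 1]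
    exact Real.summable_pow_div_factorial (|y| + 1)
  have hterm : ∀ (j : ℕ) (z : ℝ), besselCoeff m (j + 1) * ((j + 1 : ℕ) * z ^ (j + 1 - 1)) =
      -(besselCoeff (m + 1) j * z ^ j) := fun j z => by
    rw [← neg_mul, ← besselCoeff_succ_mul]
    push_cast
    rw [mul_assoc]
  have hderiv := hasDerivAt_tsum_of_isPreconnected (𝕜 := ℝ) (y := y) (y₀ := y)
    (t := Metric.ball 0 (|y| + 1)) (g := fun j z => besselCoeff m j * z ^ j)
    (g' := fun j z => besselCoeff m j * (j * z ^ (j - 1))) hbound Metric.isOpen_ball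
    (convex_ball _ _).isPreconnected (fun j z _ => (hasDerivAt_pow j z).const_mul _)
    (fun j z hz => ?_) (by simp) (summable_besselAux m y) (by simp)
  · convert! hderiv using 1
    have hs : Summable fun j : ℕ => besselCoeff m j * (j * y ^ (j - 1)) := by
      rw [← summable_nat_add_iff 1]
      simpa only [hterm] using (summable_besselAux (m + 1) y).neg
    rw [hs.tsum_eq_zero_add]
    simp only [hterm, tsum_neg, besselAux]
    simp
  · have hz' : |z| ≤ |y| + 1 := by simpa using (mem_ball_zero_iff.mp hz).le
    cases j with
    | zero => simp
    | succ j =>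
      rw [hterm, norm_neg, Real.norm_eq_abs, abs_mul, abs_pow, Nat.add_sub_cancel,
        div_eq_mul_one_div, mul_comm]
      gcongr
      exact abs_besselCoeff_le (m + 1) j

theorem besselAux_recurrence (m : ℕ) (y : ℝ) :
    besselAux m y = ((m : ℝ) + 1) * besselAux (m + 1) y - y * besselAux (m + 2) y := by
  have hs := summable_besselAux (m + 1) y
  have hshift : ∀ j : ℕ, besselCoeff (m + 1) (j + 1) * ((j + 1 : ℕ) : ℝ) * y ^ (j + 1) =
      -y * (besselCoeff (m + 2) j * y ^ j) := fun j => by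
    push_cast
    rw [besselCoeff_succ_mul]
    ring
  have hs' : Summable fun j : ℕ => besselCoeff (m + 1) j * (j : ℝ) * y ^ j := by
    rw [← summable_nat_add_iff 1]
    simpa only [hshift] using (summable_besselAux (m + 2) y).mul_left (-y)
  have hsum : ∑' j : ℕ, besselCoeff (m + 1) j * (j : ℝ) * y ^ j = -y * besselAux (m + 2) y := by
    rw [hs'.tsum_eq_zero_add]
    simp only [hshift, tsum_mul_left, besselAux]
    simp
  calc besselAux m y
      = ∑' j : ℕ, (((m : ℝ) + 1) * (besselCoeff (m + 1) j * y ^ j) +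
          besselCoeff (m + 1) j * (j : ℝ) * y ^ j) :=
        tsum_congr fun j => by rw [besselCoeff_eq]; ring
    _ = _ := by
        rw [(hs.mul_left _).tsum_add hs', tsum_mul_left, hsum, ← besselAux]
        ring

theorem differentiable_besselJ (m : ℕ) : Differentiable ℝ (besselJ m) := by
  have hg : Differentiable ℝ (besselAux m) := fun y => (hasDerivAt_besselAux m y).differentiableAt
  rw [funext (besselJ_eq_pow_mul_besselAux m)]
  fun_prop

theorem mul_deriv_besselJ (m : ℕ) (x : ℝ) :
    x * deriv (besselJ m) x = m * besselJ m x - x * besselJ (m + 1) x := by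
  have hx : HasDerivAt (fun x : ℝ => x / 2) (1 / 2) x := (hasDerivAt_id x).div_const 2
  have h := (hx.fun_pow m).fun_mul
    ((hasDerivAt_besselAux m ((x / 2) ^ 2)).comp x (hx.fun_pow 2))
  have hJ : HasDerivAt (besselJ m) _ x :=
    h.congr_of_eventuallyEq (.of_forall (besselJ_eq_pow_mul_besselAux m))
  rw [hJ.deriv, besselJ_eq_pow_mul_besselAux, besselJ_eq_pow_mul_besselAux]
  cases m with
  | zero => norm_num [Function.comp_apply]; ring_nf; simp
  | succ m => simp; ring

theorem besselJ_recurrence (m : ℕ) (x : ℝ) :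
    x * besselJ m x + x * besselJ (m + 2) x = 2 * ((m : ℝ) + 1) * besselJ (m + 1) x := by
  simp only [besselJ_eq_pow_mul_besselAux]
  rw [besselAux_recurrence m]
  ring

theorem mul_deriv_besselJ_succ (m : ℕ) (x : ℝ) :
    x * deriv (besselJ (m + 1)) x = x * besselJ m x - ((m : ℝ) + 1) * besselJ (m + 1) x := by
  have h := mul_deriv_besselJ (m + 1) x
  push_cast at h
  linear_combination h - besselJ_recurrence m x

theorem hasDerivAt_ofReal_besselJ_mul (m : ℕ) (κ t : ℝ) :
    HasDerivAt (fun t : ℝ => (besselJ m (κ * t) : ℂ))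
      (((deriv (besselJ m) (κ * t) : ℝ) : ℂ) * κ) t := by
  have h := ((differentiable_besselJ m (κ * t)).hasDerivAt.comp t
    ((hasDerivAt_id t).const_mul κ)).ofReal_comp
  simpa using! h

theorem hasDerivAt_exp_mul_pow_mul_besselJ (n m : ℕ) (κ t : ℝ) :
    HasDerivAt (fun t : ℝ => Complex.exp (Complex.I * κ * t) * (t : ℂ) ^ (n + 1) *
        ((besselJ m (κ * t) : ℂ) - Complex.I * (besselJ (m + 1) (κ * t) : ℂ)))
      (((n : ℂ) + m + 1) *
          ((t : ℂ) ^ n * Complex.exp (Complex.I * κ * t) * (besselJ m (κ * t) : ℂ)) -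
        Complex.I * ((n : ℂ) - m) *
          ((t : ℂ) ^ n * Complex.exp (Complex.I * κ * t) * (besselJ (m + 1) (κ * t) : ℂ))) t := by
  have hexp : HasDerivAt (fun t : ℝ => Complex.exp (Complex.I * κ * t))
      (Complex.exp (Complex.I * κ * t) * (Complex.I * κ)) t := by
    simpa using! (((hasDerivAt_id (t : ℂ)).const_mul (Complex.I * κ)).cexp).comp_ofReal
  have hpow : HasDerivAt (fun t : ℝ => (t : ℂ) ^ (n + 1)) (((n : ℂ) + 1) * (t : ℂ) ^ n) t := by
    simpa using! (hasDerivAt_pow (n + 1) (t : ℂ)).comp_ofReal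
  have h := (hexp.fun_mul hpow).fun_mul ((hasDerivAt_ofReal_besselJ_mul m κ t).fun_sub
    ((hasDerivAt_ofReal_besselJ_mul (m + 1) κ t).const_mul Complex.I))
  refine h.congr_deriv ?_
  have h₁ := congrArg (Complex.ofReal) (mul_deriv_besselJ m (κ * t))
  have h₂ := congrArg (Complex.ofReal) (mul_deriv_besselJ_succ m (κ * t))
  push_cast at h₁ h₂
  linear_combination (t : ℂ) ^ n * Complex.exp (Complex.I * κ * t) *
    (h₁ - Complex.I * h₂ - κ * t * (besselJ (m + 1) (κ * t) : ℂ) * Complex.I_sq)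

theorem stmt_15 (n m : ℕ) (κ b : ℝ) (hκ : κ ≠ 0) :
    ∫ t in (0:ℝ)..b, (t : ℂ) ^ n * Complex.exp (Complex.I * κ * t) * (besselJ m (κ * t) : ℂ) =
      (Complex.exp (Complex.I * κ * b) * (b : ℂ) ^ (n + 1) / ((n : ℂ) + m + 1)) *
          ((besselJ m (κ * b) : ℂ) - Complex.I * (besselJ (m + 1) (κ * b) : ℂ)) +
        (Complex.I * ((n : ℂ) - m) / ((n : ℂ) + m + 1)) *
          ∫ t in (0:ℝ)..b,
            (t : ℂ) ^ n * Complex.exp (Complex.I * κ * t) * (besselJ (m + 1) (κ * t) : ℂ) := by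
  have hcont : ∀ k : ℕ, Continuous fun t : ℝ =>
      (t : ℂ) ^ n * Complex.exp (Complex.I * κ * t) * (besselJ k (κ * t) : ℂ) := fun k => by
    have hJ : Continuous (besselJ k) := (differentiable_besselJ k).continuous
    fun_prop
  have hm := ((hcont m).const_mul ((n : ℂ) + m + 1)).intervalIntegrable (μ := volume) 0 b
  have hm' := ((hcont (m + 1)).const_mul (Complex.I * ((n : ℂ) - m))).intervalIntegrable
    (μ := volume) 0 b
  have h := intervalIntegral.integral_eq_sub_of_hasDerivAt
    (fun t _ => hasDerivAt_exp_mul_pow_mul_besselJ n m κ t) (hm.sub hm')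
  rw [intervalIntegral.integral_sub hm hm', intervalIntegral.integral_const_mul,
    intervalIntegral.integral_const_mul] at h
  simp only [Complex.ofReal_zero, zero_pow n.succ_ne_zero, mul_zero, zero_mul, sub_zero] at h
  have hne : (n : ℂ) + m + 1 ≠ 0 := by exact_mod_cast (n + m).succ_ne_zero
  refine mul_left_cancel₀ hne ?_
  rw [mul_add, ← mul_assoc, ← mul_assoc, mul_div_cancel₀ _ hne, mul_div_cancel₀ _ hne]
  linear_combination h
end
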